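/- arXiv:2004.12177 — 2 statements merged into one kernel-verified Lean document; each statement's English description precedes it below -/
import Mathlib

section
/- For j ∈ ℕ let a_j = (2j)!/(j!·2^j), the number of fixed-point-free involutions of a 2j-element set (so a₀ = 1), and for j ≥ 1 let N_{2j} be the number of pairs (σ, τ) where σ ∈ Perm(Fin 2j), τ ∈ Perm(Fin 2j) is a fixed-point-free involution, and the subgroup of Perm(Fin 2j) generated by σ and τ acts transitively on Fin 2j. Then for every n ≥ 1: (2n)!·a_n = Σ_{j=1}^{n} binom(2n−1, 2j−1) · N_{2j} · (2n−2j)! · a_{n−j}. -/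
namespace PermInvolution

open Equiv Finset

/-- The fixed-point-free involutions of `X`. -/
def fpfInvolutions (X : Type*) : Set (Perm X) := {t | t * t = 1 ∧ ∀ x, t x ≠ x}

/-- The orbit of `x` under the group generated by a pair of permutations. -/
def pairOrbit {X : Type*} (p : Perm X × Perm X) (x : X) : Set X :=
  {y | ∃ g ∈ Subgroup.closure ({p.1, p.2} : Set (Perm X)), g x = y}

/-- The pairs of a permutation and a fixed-point-free involution. -/
def involutionPairs (X : Type*) : Set (Perm X × Perm X) := {p | p.2 ∈ fpfInvolutions X}

/-- The pairs of a permutation and a fixed-point-free involution generating a transitive group. -/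
def transitivePairs (X : Type*) : Set (Perm X × Perm X) :=
  {p | (p.2 * p.2 = 1 ∧ ∀ x, p.2 x ≠ x) ∧
    ∀ x y : X, ∃ g ∈ Subgroup.closure ({p.1, p.2} : Set (Perm X)), g x = y}

theorem involutionPairs_eq_prod (X : Type*) :
    involutionPairs X = Set.univ ×ˢ fpfInvolutions X := by
  ext p; simp [involutionPairs]

theorem transitivePairs_subset (X : Type*) : transitivePairs X ⊆ involutionPairs X :=
  fun _ hp => hp.1

theorem transitivePairs_permCongr {X Y : Type*} (e : X ≃ Y) {p : Perm X × Perm X}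
    (hp : p ∈ transitivePairs X) :
    (e.permCongrHom p.1, e.permCongrHom p.2) ∈ transitivePairs Y := by
  refine ⟨⟨?_, fun x hx => hp.1.2 (e.symm x) ?_⟩, fun x y => ?_⟩
  · simp only [← map_mul, hp.1.1, map_one]
  · rw [Equiv.eq_symm_apply]
    exact hx
  · obtain ⟨g, hg, hgx⟩ := hp.2 (e.symm x) (e.symm y)
    refine ⟨e.permCongrHom g, ?_, ?_⟩
    · have h := Subgroup.mem_map_of_mem e.permCongrHom.toMonoidHom hg
      rw [MonoidHom.map_closure, Set.image_pair] at h
      exact h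
    · change e (g (e.symm x)) = y
      rw [hgx, e.apply_symm_apply]

theorem ncard_transitivePairs_le {X Y : Type*} [Finite Y] (e : X ≃ Y) :
    (transitivePairs X).ncard ≤ (transitivePairs Y).ncard :=
  Set.ncard_le_ncard_of_injOn (fun p => (e.permCongrHom p.1, e.permCongrHom p.2))
    (fun _ hp => transitivePairs_permCongr e hp)
    (fun _ _ _ _ h => Prod.ext (e.permCongrHom.injective (congrArg Prod.fst h))
      (e.permCongrHom.injective (congrArg Prod.snd h))) (Set.toFinite _)

section Counting

variable {X Y : Type*} [Fintype X] [Fintype Y]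

theorem ncard_involutionPairs :
    (involutionPairs X).ncard = (Fintype.card X).factorial * (fpfInvolutions X).ncard := by
  classical
  rw [involutionPairs_eq_prod, Set.ncard_prod, Set.ncard_univ, Nat.card_eq_fintype_card,
    Fintype.card_perm]

theorem support_eq_univ_of_mem_fpfInvolutions [DecidableEq X] {t : Perm X}
    (ht : t ∈ fpfInvolutions X) : t.support = univ := by
  ext x; simpa using ht.2 x

theorem even_card_of_mem_fpfInvolutions {t : Perm X} (ht : t ∈ fpfInvolutions X) :
    2 ∣ Fintype.card X := by
  classical
  have h := Perm.two_dvd_card_support (σ := t) (by rw [pow_two]; exact ht.1)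
  rwa [support_eq_univ_of_mem_fpfInvolutions ht] at h

theorem involutionPairs_eq_empty_of_odd (h : ¬ 2 ∣ Fintype.card X) : involutionPairs X = ∅ :=
  Set.eq_empty_of_forall_notMem fun _ hp => h (even_card_of_mem_fpfInvolutions hp)

theorem ncard_transitivePairs_of_odd (h : ¬ 2 ∣ Fintype.card X) :
    (transitivePairs X).ncard = 0 := by
  rw [Set.subset_empty_iff.mp ((transitivePairs_subset X).trans
    (involutionPairs_eq_empty_of_odd h).subset), Set.ncard_empty]

theorem mem_fpfInvolutions_iff_cycleType [DecidableEq X] {n : ℕ} (hX : Fintype.card X = 2 * n)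
    (t : Perm X) : t ∈ fpfInvolutions X ↔ t.cycleType = Multiset.replicate n 2 := by
  constructor
  · intro ht
    have h1 := Perm.cycleType_of_pow_prime_eq_one (σ := t) (p := 2) (by rw [pow_two]; exact ht.1)
    have h2 := t.sum_cycleType
    rw [support_eq_univ_of_mem_fpfInvolutions ht, card_univ, hX, h1, Multiset.sum_replicate,
      smul_eq_mul] at h2
    rw [h1]
    congr 1
    omega
  · intro ht
    have h2 := t.sum_cycleType
    rw [ht, Multiset.sum_replicate, smul_eq_mul, mul_comm, ← hX] at h2
    have hs := (Finset.card_eq_iff_eq_univ _).mp h2.symm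
    refine ⟨?_, fun x => ?_⟩
    · rw [← pow_two, ← orderOf_dvd_iff_pow_eq_one, ← Perm.lcm_cycleType, Multiset.lcm_dvd, ht]
      intro b hb
      rw [Multiset.eq_of_mem_replicate hb]
    · exact Perm.mem_support.mp (hs ▸ mem_univ x)

theorem ncard_fpfInvolutions {n : ℕ} (hX : Fintype.card X = 2 * n) :
    (fpfInvolutions X).ncard = (2 * n).factorial / (n.factorial * 2 ^ n) := by
  classical
  have h : fpfInvolutions X =
      ({g | g.cycleType = Multiset.replicate n 2} : Finset (Perm X)) := by
    ext t
    simp [mem_fpfInvolutions_iff_cycleType hX]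
  rw [h, Set.ncard_coe_finset, Perm.card_of_cycleType, if_pos, hX]
  · rcases Nat.eq_zero_or_pos n with rfl | hn
    · simp
    · rw [Multiset.toFinset_replicate, if_neg hn.ne']
      simp [mul_comm]
  · refine ⟨by simp [hX, mul_comm], fun b hb => ?_⟩
    rw [Multiset.eq_of_mem_replicate hb]

theorem ncard_transitivePairs_congr (h : Fintype.card X = Fintype.card Y) :
    (transitivePairs X).ncard = (transitivePairs Y).ncard :=
  (ncard_transitivePairs_le (Fintype.equivOfCardEq h)).antisymm
    (ncard_transitivePairs_le (Fintype.equivOfCardEq h).symm)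

theorem ncard_involutionPairs_congr (h : Fintype.card X = Fintype.card Y) :
    (involutionPairs X).ncard = (involutionPairs Y).ncard := by
  by_cases h2 : 2 ∣ Fintype.card X
  · obtain ⟨n, hn⟩ := h2
    rw [ncard_involutionPairs, ncard_involutionPairs, ncard_fpfInvolutions hn,
      ncard_fpfInvolutions (h ▸ hn), h]
  · rw [involutionPairs_eq_empty_of_odd h2, involutionPairs_eq_empty_of_odd (h ▸ h2),
      Set.ncard_empty, Set.ncard_empty]

end Counting

section Orbits

variable {X : Type*}

theorem mem_pairOrbit_self (p : Perm X × Perm X) (x : X) : x ∈ pairOrbit p x :=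
  ⟨1, one_mem _, rfl⟩

theorem apply_mem_pairOrbit_iff {p : Perm X × Perm X} {g : Perm X}
    (hg : g ∈ Subgroup.closure ({p.1, p.2} : Set (Perm X))) (x y : X) :
    g y ∈ pairOrbit p x ↔ y ∈ pairOrbit p x := by
  constructor
  · rintro ⟨k, hk, hkx⟩
    exact ⟨g⁻¹ * k, mul_mem (inv_mem hg) hk, by simp [hkx]⟩
  · rintro ⟨k, hk, hkx⟩
    exact ⟨g * k, mul_mem hg hk, by simp [hkx]⟩

theorem mem_transitivePairs_iff {p : Perm X × Perm X} (x : X) :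
    p ∈ transitivePairs X ↔ p ∈ involutionPairs X ∧ pairOrbit p x = Set.univ := by
  refine and_congr_right fun _ => ⟨fun h => Set.eq_univ_of_forall (h x), fun h y z => ?_⟩
  obtain ⟨g, hg, hgx⟩ : y ∈ pairOrbit p x := h ▸ Set.mem_univ y
  obtain ⟨k, hk, hkx⟩ : z ∈ pairOrbit p x := h ▸ Set.mem_univ z
  exact ⟨k * g⁻¹, mul_mem hk (inv_mem hg), by simp [← hgx, hkx]⟩

variable (P : X → Prop) [DecidablePred P]

/-- Gluing a pair of permutations of a subtype and a pair of permutations of its complement. -/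
def gluePairs (q : (Perm {x // P x} × Perm {x // P x}) ×
    (Perm {x // ¬ P x} × Perm {x // ¬ P x})) : Perm X × Perm X :=
  (Perm.subtypeCongrHom P (q.1.1, q.2.1), Perm.subtypeCongrHom P (q.1.2, q.2.2))

theorem gluePairs_injective : Function.Injective (gluePairs P) := by
  rintro ⟨⟨a, b⟩, c, d⟩ ⟨⟨a', b'⟩, c', d'⟩ h
  have h1 := Perm.subtypeCongrHom_injective P (congrArg Prod.fst h)
  have h2 := Perm.subtypeCongrHom_injective P (congrArg Prod.snd h)
  simp_all

theorem subtypeCongrHom_mem_fpfInvolutions_iff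
    (q : Perm {x // P x} × Perm {x // ¬ P x}) :
    Perm.subtypeCongrHom P q ∈ fpfInvolutions X ↔
      q.1 ∈ fpfInvolutions _ ∧ q.2 ∈ fpfInvolutions _ := by
  have h1 : Perm.subtypeCongrHom P q * Perm.subtypeCongrHom P q = 1 ↔
      q.1 * q.1 = 1 ∧ q.2 * q.2 = 1 := by
    rw [← map_mul, map_eq_one_iff _ (Perm.subtypeCongrHom_injective P), Prod.ext_iff]
    rfl
  have h2 : (∀ x, Perm.subtypeCongrHom P q x ≠ x) ↔ (∀ x, q.1 x ≠ x) ∧ ∀ x, q.2 x ≠ x := by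
    constructor
    · refine fun h => ⟨fun x hx => h x ?_, fun x hx => h x ?_⟩
      · exact (Perm.subtypeCongr.left_apply_subtype q.1 q.2 x).trans (congrArg _ hx)
      · exact (Perm.subtypeCongr.right_apply_subtype q.1 q.2 x).trans (congrArg _ hx)
    · rintro ⟨hl, hr⟩ x hx
      by_cases hP : P x
      · exact hl ⟨x, hP⟩ (Subtype.ext ((Perm.subtypeCongr.left_apply q.1 q.2 hP).symm.trans hx))
      · exact hr ⟨x, hP⟩ (Subtype.ext ((Perm.subtypeCongr.right_apply q.1 q.2 hP).symm.trans hx))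
  simp only [fpfInvolutions, Set.mem_ofPred_eq, h1, h2]
  tauto

theorem pairOrbit_gluePairs (q : (Perm {x // P x} × Perm {x // P x}) ×
    (Perm {x // ¬ P x} × Perm {x // ¬ P x})) (x : {x // P x}) :
    pairOrbit (gluePairs P q) x = Subtype.val '' pairOrbit q.1 x := by
  set K := Subgroup.closure ({(q.1.1, q.2.1), (q.1.2, q.2.2)} :
    Set (Perm {x // P x} × Perm {x // ¬ P x})) with hK
  have hglue : Subgroup.closure {(gluePairs P q).1, (gluePairs P q).2} =
      K.map (Perm.subtypeCongrHom P) := by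
    rw [hK, MonoidHom.map_closure, Set.image_pair]
    rfl
  have hfst : Subgroup.closure {q.1.1, q.1.2} = K.map (MonoidHom.fst _ _) := by
    rw [hK, MonoidHom.map_closure, Set.image_pair]
    rfl
  have happ (h : Perm {x // P x} × Perm {x // ¬ P x}) :
      Perm.subtypeCongrHom P h x = (h.1 x : X) :=
    Perm.subtypeCongr.left_apply_subtype h.1 h.2 x
  ext y
  simp only [pairOrbit, hglue, hfst, Subgroup.mem_map, Set.mem_ofPred_eq, Set.mem_image]
  constructor
  · rintro ⟨_, ⟨h, hh, rfl⟩, rfl⟩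
    exact ⟨h.1 x, ⟨h.1, ⟨h, hh, rfl⟩, rfl⟩, (happ h).symm⟩
  · rintro ⟨_, ⟨_, ⟨h, hh, rfl⟩, rfl⟩, rfl⟩
    exact ⟨_, ⟨h, hh, rfl⟩, happ h⟩

theorem subtypeCongrHom_subtypePerm (g : Perm X) (hg : ∀ x, P (g x) ↔ P x) :
    Perm.subtypeCongrHom P
      (g.subtypePerm hg, g.subtypePerm (p := fun x => ¬ P x) fun x => not_congr (hg x)) = g := by
  ext x
  by_cases hP : P x
  · exact Perm.subtypeCongr.left_apply _ _ hP
  · exact Perm.subtypeCongr.right_apply _ _ hP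

theorem setOf_pairOrbit_eq_image_gluePairs {x : X} (hx : P x) :
    {p | p ∈ involutionPairs X ∧ pairOrbit p x = {y | P y}} =
      gluePairs P '' (transitivePairs {x // P x} ×ˢ involutionPairs {x // ¬ P x}) := by
  have key (q) : (gluePairs P q ∈ involutionPairs X ∧
      pairOrbit (gluePairs P q) x = {y | P y}) ↔
      q ∈ transitivePairs {x // P x} ×ˢ involutionPairs {x // ¬ P x} := by
    have h1 : gluePairs P q ∈ involutionPairs X ↔ _ :=
      subtypeCongrHom_mem_fpfInvolutions_iff P (q.1.2, q.2.2)
    have h2 : pairOrbit (gluePairs P q) x = {y | P y} ↔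
        pairOrbit q.1 ⟨x, hx⟩ = Set.univ := by
      rw [pairOrbit_gluePairs P q ⟨x, hx⟩, ← Subtype.range_coe_subtype (p := P),
        ← Set.image_univ, Subtype.val_injective.image_injective.eq_iff]
    rw [h1, h2, Set.mem_prod, mem_transitivePairs_iff ⟨x, hx⟩]
    simp only [involutionPairs, Set.mem_ofPred_eq]
    tauto
  ext p
  constructor
  · intro hp
    have hinv {g : Perm X} (hg : g ∈ ({p.1, p.2} : Set (Perm X))) (y : X) : P (g y) ↔ P y := by
      have h := apply_mem_pairOrbit_iff (Subgroup.subset_closure hg) x y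
      rwa [hp.2] at h
    have h1 := hinv (g := p.1) (by simp)
    have h2 := hinv (g := p.2) (by simp)
    let q : (Perm {x // P x} × Perm {x // P x}) × (Perm {x // ¬ P x} × Perm {x // ¬ P x}) :=
      ((p.1.subtypePerm h1, p.2.subtypePerm h2),
        (p.1.subtypePerm fun x => not_congr (h1 x), p.2.subtypePerm fun x => not_congr (h2 x)))
    have hq : gluePairs P q = p :=
      Prod.ext (subtypeCongrHom_subtypePerm P p.1 h1) (subtypeCongrHom_subtypePerm P p.2 h2)
    exact ⟨q, (key q).mp (hq.symm ▸ hp), hq⟩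
  · rintro ⟨q, hq, rfl⟩
    exact (key q).mpr hq

theorem ncard_setOf_pairOrbit_eq {x : X} (hx : P x) :
    {p | p ∈ involutionPairs X ∧ pairOrbit p x = {y | P y}}.ncard =
      (transitivePairs {x // P x}).ncard * (involutionPairs {x // ¬ P x}).ncard := by
  rw [setOf_pairOrbit_eq_image_gluePairs P hx,
    Set.ncard_image_of_injective _ (gluePairs_injective P), Set.ncard_prod]

end Orbits

theorem ncard_involutionPairs_fin_succ (m : ℕ) :
    (involutionPairs (Fin (m + 1))).ncard =
      ∑ i ∈ range (m + 1), m.choose i *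
        ((transitivePairs (Fin (i + 1))).ncard * (involutionPairs (Fin (m - i))).ncard) := by
  classical
  let f : Perm (Fin (m + 1)) × Perm (Fin (m + 1)) → Finset (Fin (m + 1)) :=
    fun p => (pairOrbit p 0).toFinset.erase 0
  have hcard : #(univ.erase (0 : Fin (m + 1))) = m := by simp
  have hmaps : ((involutionPairs (Fin (m + 1))).toFinset : Set _).MapsTo f
      ((univ.erase (0 : Fin (m + 1))).powerset : Finset _) := by
    intro p _
    simp [f]
  have hfiber : ∀ S ∈ (univ.erase (0 : Fin (m + 1))).powerset,
      #{p ∈ (involutionPairs (Fin (m + 1))).toFinset | f p = S} =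
        (transitivePairs (Fin (#S + 1))).ncard * (involutionPairs (Fin (m - #S))).ncard := by
    intro S hS
    have h0 : (0 : Fin (m + 1)) ∉ S := fun h => by simpa using mem_powerset.mp hS h
    have hset : (({p ∈ (involutionPairs (Fin (m + 1))).toFinset | f p = S} : Finset _) : Set _) =
        {p | p ∈ involutionPairs (Fin (m + 1)) ∧ pairOrbit p 0 = {y | y ∈ insert 0 S}} := by
      ext p
      simp only [coe_filter, Set.mem_toFinset, Set.mem_ofPred_eq]
      refine and_congr_right fun _ => ?_
      have hmem : (0 : Fin (m + 1)) ∈ (pairOrbit p 0).toFinset :=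
        Set.mem_toFinset.mpr (mem_pairOrbit_self p 0)
      rw [erase_eq_iff_eq_insert hmem h0, ← Finset.coe_inj, Set.coe_toFinset]
      rfl
    have hc : #(insert 0 S) = #S + 1 := card_insert_of_notMem h0
    rw [← Set.ncard_coe_finset, hset, ncard_setOf_pairOrbit_eq _ (mem_insert_self 0 S)]
    congr 1
    · apply ncard_transitivePairs_congr
      rw [Fintype.card_coe, hc, Fintype.card_fin]
    · apply ncard_involutionPairs_congr
      rw [Fintype.card_subtype_compl, Fintype.card_coe, hc, Fintype.card_fin, Fintype.card_fin]
      omega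
  rw [Set.ncard_eq_toFinset_card', card_eq_sum_card_fiberwise hmaps, sum_congr rfl hfiber,
    sum_powerset_apply_card (fun k =>
      (transitivePairs (Fin (k + 1))).ncard * (involutionPairs (Fin (m - k))).ncard), hcard]
  simp only [smul_eq_mul]

theorem sum_range_two_mul_of_even_eq_zero (g : ℕ → ℕ) (hg : ∀ i, g (2 * i) = 0) (n : ℕ) :
    ∑ i ∈ range (2 * n), g i = ∑ j ∈ Icc 1 n, g (2 * j - 1) := by
  induction n with
  | zero => simp
  | succ k ih =>
    rw [sum_Icc_succ_top (by omega), ← ih, show 2 * (k + 1) = 2 * k + 1 + 1 by ring,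
      sum_range_succ, sum_range_succ, hg]
    simp

end PermInvolution

/-- The recursion `2n·a_n = Σ_j 2j·t_{2j}·a_j·a_{n-j}` in integer form: with
`a_j = (2j)!/(j!·2^j)` the number of fixed-point-free involutions of a `2j`-set
and `N_{2j}` the number of pairs (permutation, fixed-point-free involution) of
`Fin (2j)` generating a transitive subgroup, one has
`(2n)!·a_n = Σ_{j=1}^{n} C(2n-1, 2j-1)·N_{2j}·(2n-2j)!·a_{n-j}`. -/
theorem fixed_point_free_involution_transitive_recursion
    (a N : ℕ → ℕ)
    (ha : ∀ j : ℕ, a j = (2 * j).factorial / (j.factorial * 2 ^ j))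
    (hN : ∀ j : ℕ, 1 ≤ j →
      N j = Set.ncard {p : Equiv.Perm (Fin (2 * j)) × Equiv.Perm (Fin (2 * j)) |
        (p.2 * p.2 = 1 ∧ ∀ x, p.2 x ≠ x) ∧
        ∀ x y : Fin (2 * j),
          ∃ g ∈ Subgroup.closure ({p.1, p.2} : Set (Equiv.Perm (Fin (2 * j)))),
            g x = y}) :
    ∀ n : ℕ, 1 ≤ n →
      (2 * n).factorial * a n =
        ∑ j ∈ Finset.Icc 1 n,
          Nat.choose (2 * n - 1) (2 * j - 1) * N j * (2 * n - 2 * j).factorial *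
            a (n - j) := by
  intro n hn
  have hF (k : ℕ) : (PermInvolution.involutionPairs (Fin (2 * k))).ncard =
      (2 * k).factorial * a k := by
    rw [PermInvolution.ncard_involutionPairs,
      PermInvolution.ncard_fpfInvolutions (Fintype.card_fin _),
      Fintype.card_fin, ha]
  have hT (j : ℕ) (hj : 1 ≤ j) : N j = (PermInvolution.transitivePairs (Fin (2 * j))).ncard :=
    hN j hj
  have hrec := PermInvolution.ncard_involutionPairs_fin_succ (2 * n - 1)
  rw [show 2 * n - 1 + 1 = 2 * n by omega, hF,
    PermInvolution.sum_range_two_mul_of_even_eq_zero _ fun i => by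
      rw [PermInvolution.ncard_transitivePairs_of_odd (by rw [Fintype.card_fin]; omega)]
      simp] at hrec
  rw [hrec]
  refine Finset.sum_congr rfl fun j hj => ?_
  obtain ⟨h1, h2⟩ := Finset.mem_Icc.mp hj
  rw [show 2 * j - 1 + 1 = 2 * j by omega, show 2 * n - 1 - (2 * j - 1) = 2 * (n - j) by omega,
    hF, hT j h1, ← Nat.mul_sub]
  ring
end

section
/- For n ≥ 1 let I_{2n} be the set of fixed-point-free involutions in Perm(Fin 2n), and let T_n be the number of pairs (σ, τ) ∈ Perm(Fin 2n) × I_{2n} such that the subgroup of Perm(Fin 2n) generated by σ and τ acts transitively on Fin 2n. Then the probability T_n / ((2n)! · |I_{2n}|) that a uniformly random such pair generates a transitive subgroup tends to 1 as n → ∞. -/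
open Finset in
theorem card_perm_preserving {α : Type*} [Fintype α] [DecidableEq α] (s : Finset α) :
    #{σ : Equiv.Perm α | ∀ x, σ x ∈ s ↔ x ∈ s} =
      (#s).factorial * (Fintype.card α - #s).factorial := by
  have h := DomMulAct.stabilizer_card (fun a : α => decide (a ∈ s))
  rw [Fintype.card_subtype] at h
  simpa [funext_iff, Fintype.card_subtype, ← Finset.compl_filter, Finset.card_compl] using h

section FixedPointFreeInvolution

open Finset

variable {α : Type*} [Fintype α] [LinearOrder α] {τ : Equiv.Perm α}

/-- The smaller elements of the two-element cycles of an involution. -/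
def lowerPoints (τ : Equiv.Perm α) : Finset α := {x | x < τ x}

theorem card_union_map_of_subset_lowerPoints (hτ : τ * τ = 1) {A : Finset α}
    (hA : A ⊆ lowerPoints τ) : #(A ∪ A.map τ.toEmbedding) = 2 * #A := by
  have hinv : ∀ x, τ (τ x) = x := fun x => by simpa using congrArg (· x) hτ
  rw [card_union_of_disjoint, card_map, two_mul]
  rw [disjoint_left]
  intro x hx hx'
  obtain ⟨y, hy, rfl⟩ := mem_map.1 hx'
  have h₁ := hA hx
  have h₂ := hA hy
  simp only [lowerPoints, mem_filter, mem_univ, true_and, Equiv.coe_toEmbedding, hinv] at h₁ h₂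
  exact lt_asymm h₁ h₂

theorem inter_lowerPoints_union_map (hτ : τ * τ = 1) (hfix : ∀ x, τ x ≠ x) {s : Finset α}
    (hs : ∀ x, τ x ∈ s ↔ x ∈ s) :
    s ∩ lowerPoints τ ∪ (s ∩ lowerPoints τ).map τ.toEmbedding = s := by
  have hinv : ∀ x, τ (τ x) = x := fun x => by simpa using congrArg (· x) hτ
  ext x
  simp only [lowerPoints, mem_union, mem_inter, mem_filter, mem_univ, true_and, mem_map,
    Equiv.coe_toEmbedding]
  constructor
  · rintro (h | ⟨y, h, rfl⟩)
    · exact h.1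
    · exact (hs y).2 h.1
  · intro hx
    rcases lt_or_gt_of_ne (hfix x) with h | h
    · exact Or.inr ⟨τ x, ⟨(hs x).2 hx, by rwa [hinv]⟩, hinv x⟩
    · exact Or.inl ⟨hx, h⟩

theorem two_mul_card_lowerPoints (hτ : τ * τ = 1) (hfix : ∀ x, τ x ≠ x) :
    2 * #(lowerPoints τ) = Fintype.card α := by
  rw [← card_union_map_of_subset_lowerPoints hτ Subset.rfl]
  have h := inter_lowerPoints_union_map hτ hfix (s := univ) (by simp)
  rw [univ_inter] at h
  rw [h, card_univ]

theorem exists_invariant_of_not_transitive {σ τ : Equiv.Perm α}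
    (h : ¬ ∀ x y, ∃ g ∈ Subgroup.closure ({σ, τ} : Set (Equiv.Perm α)), g x = y) :
    ∃ s : Finset α, s ≠ ∅ ∧ s ≠ univ ∧ (∀ x, σ x ∈ s ↔ x ∈ s) ∧ ∀ x, τ x ∈ s ↔ x ∈ s := by
  classical
  push Not at h
  obtain ⟨x, y, hxy⟩ := h
  have key : ∀ ρ ∈ Subgroup.closure ({σ, τ} : Set (Equiv.Perm α)), ∀ z,
      (∃ g ∈ Subgroup.closure ({σ, τ} : Set (Equiv.Perm α)), g x = ρ z) ↔
        ∃ g ∈ Subgroup.closure ({σ, τ} : Set (Equiv.Perm α)), g x = z := by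
    intro ρ hρ z
    constructor
    · rintro ⟨g, hg, hgx⟩
      exact ⟨ρ⁻¹ * g, mul_mem (inv_mem hρ) hg, by simp [hgx]⟩
    · rintro ⟨g, hg, hgx⟩
      exact ⟨ρ * g, mul_mem hρ hg, by simp [hgx]⟩
  refine ⟨univ.filter fun z => ∃ g ∈ Subgroup.closure ({σ, τ} : Set (Equiv.Perm α)), g x = z,
    ?_, ?_, ?_, ?_⟩
  · exact ne_empty_of_mem (mem_filter.2 ⟨mem_univ x, 1, one_mem _, rfl⟩)
  · intro hu
    obtain ⟨-, g, hg, hgy⟩ := mem_filter.1 (hu ▸ mem_univ y)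
    exact hxy g hg hgy
  · simpa using key σ (Subgroup.subset_closure (by simp))
  · simpa using key τ (Subgroup.subset_closure (by simp))

open scoped Classical in
theorem card_not_transitive_le {n : ℕ} (hn : Fintype.card α = 2 * n) (hτ : τ * τ = 1)
    (hfix : ∀ x, τ x ≠ x) :
    #{σ : Equiv.Perm α |
        ¬ ∀ x y, ∃ g ∈ Subgroup.closure ({σ, τ} : Set (Equiv.Perm α)), g x = y} ≤
      ∑ m ∈ range (n + 1), n.choose m *
        (if 0 < m ∧ m < n then (2 * m).factorial * (2 * n - 2 * m).factorial else 0) := by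
  have hR : #(lowerPoints τ) = n := by
    have := two_mul_card_lowerPoints hτ hfix
    omega
  have hsum := sum_powerset_apply_card (x := lowerPoints τ)
    (fun m => if 0 < m ∧ m < n then (2 * m).factorial * (2 * n - 2 * m).factorial else 0)
  simp only [hR, smul_eq_mul] at hsum
  rw [← hsum, ← sum_filter]
  calc _ ≤ #(((lowerPoints τ).powerset.filter fun A => 0 < #A ∧ #A < n).biUnion fun A =>
          {σ : Equiv.Perm α | ∀ x, σ x ∈ A ∪ A.map τ.toEmbedding ↔
            x ∈ A ∪ A.map τ.toEmbedding}) := by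
        refine card_le_card fun σ hσ => ?_
        obtain ⟨s, hs₀, hs₁, hsσ, hsτ⟩ := exists_invariant_of_not_transitive (mem_filter.1 hσ).2
        have hs := inter_lowerPoints_union_map hτ hfix hsτ
        refine mem_biUnion.2 ⟨s ∩ lowerPoints τ, mem_filter.2
          ⟨mem_powerset.2 inter_subset_right, ?_, ?_⟩, ?_⟩
        · rw [card_pos, nonempty_iff_ne_empty]
          intro h
          rw [h] at hs
          exact hs₀ (by simpa using hs.symm)
        · have hc := card_union_map_of_subset_lowerPoints hτ (inter_subset_right (s₁ := s))
          rw [hs] at hc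
          have := (card_lt_iff_ne_univ s).2 hs₁
          omega
        · rw [hs]
          simpa using hsσ
    _ ≤ _ := by
        refine card_biUnion_le.trans (sum_le_sum fun A hA => ?_)
        have hA' := mem_powerset.1 (mem_filter.1 hA).1
        have h := card_perm_preserving (A ∪ A.map τ.toEmbedding)
        rw [card_union_map_of_subset_lowerPoints hτ hA', hn] at h
        exact le_of_eq (by convert h)

end FixedPointFreeInvolution

theorem sq_choose_le_choose_two_mul (n k : ℕ) :
    n.choose k * n.choose k ≤ (2 * n).choose (2 * k) := by
  rw [two_mul n, Nat.add_choose_eq]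
  exact Finset.single_le_sum (f := fun ij : ℕ × ℕ => n.choose ij.1 * n.choose ij.2)
    (fun _ _ => Nat.zero_le _)
    (Finset.HasAntidiagonal.mem_antidiagonal.2 (two_mul k).symm :
      (k, k) ∈ Finset.HasAntidiagonal.antidiagonal (2 * k))

theorem choose_two_le_choose {n k : ℕ} (hk : 2 ≤ k) (hkn : k + 2 ≤ n) :
    n.choose 2 ≤ n.choose k := by
  have half : ∀ k, 2 ≤ k → k ≤ n / 2 → n.choose 2 ≤ n.choose k := by
    intro k hk
    induction k, hk using Nat.le_induction with
    | base => simp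
    | succ k hk ih =>
      intro h
      exact (ih (by omega)).trans (Nat.choose_le_succ_of_lt_half_left (by omega))
  by_cases h : k ≤ n / 2
  · exact half k hk h
  · rw [← Nat.choose_symm (show k ≤ n by omega)]
    exact half (n - k) (by omega) (by omega)

theorem choose_mul_factorial_mul_factorial_le {n m : ℕ} (h₀ : 0 < m) (hm : m < n) :
    n * (n - 1) * (n.choose m * ((2 * m).factorial * (2 * n - 2 * m).factorial)) ≤
      (2 * n).factorial *
        ((if m = 1 then n - 1 else 0) + (if m = n - 1 then n - 1 else 0) + 2) := by
  set f := (2 * m).factorial * (2 * n - 2 * m).factorial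
  have hC : n.choose m * (n.choose m * f) ≤ (2 * n).factorial := by
    rw [← Nat.choose_mul_factorial_mul_factorial (show 2 * m ≤ 2 * n by omega), ← mul_assoc,
      mul_assoc _ _ (2 * n - 2 * m).factorial]
    exact Nat.mul_le_mul_right _ (sq_choose_le_choose_two_mul n m)
  by_cases hend : m = 1 ∨ m = n - 1
  · have hCn : n.choose m = n := by
      rcases hend with rfl | rfl
      · simp
      · rw [Nat.choose_symm (by omega), Nat.choose_one_right]
    rw [hCn] at hC ⊢
    calc n * (n - 1) * (n * f) = n * (n * f) * (n - 1) := by ring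
      _ ≤ (2 * n).factorial * (n - 1) := Nat.mul_le_mul_right _ hC
      _ ≤ _ := Nat.mul_le_mul_left _ (by rcases hend with h | h <;> simp [← h] <;> omega)
  · push Not at hend
    have h2 := choose_two_le_choose (n := n) (k := m) (by omega) (by omega)
    have h3 : n * (n - 1) = 2 * n.choose 2 := by
      rw [Nat.choose_two_right, Nat.mul_div_cancel' (Nat.even_mul_pred_self n).two_dvd]
    rw [h3]
    calc 2 * n.choose 2 * (n.choose m * f) ≤ 2 * n.choose m * (n.choose m * f) := by gcongr
      _ = n.choose m * (n.choose m * f) * 2 := by ring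
      _ ≤ (2 * n).factorial * 2 := Nat.mul_le_mul_right _ hC
      _ ≤ _ := Nat.mul_le_mul_left _ (by omega)

theorem sum_choose_mul_factorial_mul_factorial_le {n : ℕ} (hn : 0 < n) :
    (n - 1) * ∑ m ∈ Finset.range (n + 1), n.choose m *
        (if 0 < m ∧ m < n then (2 * m).factorial * (2 * n - 2 * m).factorial else 0) ≤
      4 * (2 * n).factorial := by
  refine Nat.le_of_mul_le_mul_left ?_ hn
  rw [← mul_assoc, Finset.mul_sum]
  calc _ ≤ ∑ m ∈ Finset.range (n + 1), (2 * n).factorial *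
        ((if m = 1 then n - 1 else 0) + (if m = n - 1 then n - 1 else 0) + 2) := by
        refine Finset.sum_le_sum fun m _ => ?_
        by_cases h : 0 < m ∧ m < n
        · rw [if_pos h]
          exact choose_mul_factorial_mul_factorial_le h.1 h.2
        · simp [if_neg h]
    _ = (2 * n).factorial * ((n - 1) + (n - 1) + (n + 1) * 2) := by
        rw [← Finset.mul_sum, Finset.sum_add_distrib, Finset.sum_add_distrib,
          Finset.sum_ite_eq', Finset.sum_ite_eq']
        simp [hn, show n - 1 < n + 1 by omega]
    _ = _ := by
        rw [show (n - 1) + (n - 1) + (n + 1) * 2 = 4 * n by omega]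
        ring

open Finset in
open scoped Classical in
theorem card_transitive_pairs_ge {n : ℕ} (hn : 0 < n) :
    (n - 1) * ((2 * n).factorial *
        #{τ : Equiv.Perm (Fin (2 * n)) | τ * τ = 1 ∧ ∀ x, τ x ≠ x}) ≤
      (n - 1) * #{p : Equiv.Perm (Fin (2 * n)) × Equiv.Perm (Fin (2 * n)) |
        (p.2 * p.2 = 1 ∧ ∀ x, p.2 x ≠ x) ∧
        ∀ x y : Fin (2 * n),
          ∃ g ∈ Subgroup.closure ({p.1, p.2} : Set (Equiv.Perm (Fin (2 * n)))), g x = y} +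
      4 * ((2 * n).factorial *
        #{τ : Equiv.Perm (Fin (2 * n)) | τ * τ = 1 ∧ ∀ x, τ x ≠ x}) := by
  set I : Finset (Equiv.Perm (Fin (2 * n))) := {τ | τ * τ = 1 ∧ ∀ x, τ x ≠ x} with hI
  set trans : Equiv.Perm (Fin (2 * n)) → Equiv.Perm (Fin (2 * n)) → Prop := fun σ τ =>
    ∀ x y, ∃ g ∈ Subgroup.closure ({σ, τ} : Set (Equiv.Perm (Fin (2 * n)))), g x = y
  have hpairs : (2 * n).factorial * #I = #((univ : Finset (Equiv.Perm (Fin (2 * n)))) ×ˢ I) := by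
    simp [card_product, card_univ, Fintype.card_perm]
  have hgood : #{p ∈ univ ×ˢ I | trans p.1 p.2} = #{p : Equiv.Perm (Fin (2 * n)) ×
      Equiv.Perm (Fin (2 * n)) | (p.2 * p.2 = 1 ∧ ∀ x, p.2 x ≠ x) ∧ trans p.1 p.2} := by
    congr 1
    ext p
    simp [hI]
  have hbad : #{p ∈ univ ×ˢ I | ¬ trans p.1 p.2} ≤
      ∑ τ ∈ I, #{σ : Equiv.Perm (Fin (2 * n)) | ¬ trans σ τ} := by
    refine le_of_eq ?_
    simp only [card_filter]
    rw [sum_product_right]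
  have hbound : (n - 1) * ∑ τ ∈ I, #{σ : Equiv.Perm (Fin (2 * n)) | ¬ trans σ τ} ≤
      4 * ((2 * n).factorial * #I) := by
    rw [mul_sum, ← mul_assoc, mul_comm _ #I, ← smul_eq_mul #I]
    refine sum_le_card_nsmul _ _ _ fun τ hτ => ?_
    obtain ⟨-, h₁, h₂⟩ := mem_filter.1 hτ
    have h := (Nat.mul_le_mul_left _ (card_not_transitive_le (by simp) h₁ h₂)).trans
      (sum_choose_mul_factorial_mul_factorial_le hn)
    convert h
  calc (n - 1) * ((2 * n).factorial * #I)
      = (n - 1) * #{p ∈ univ ×ˢ I | trans p.1 p.2} +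
          (n - 1) * #{p ∈ univ ×ˢ I | ¬ trans p.1 p.2} := by
        rw [hpairs, ← mul_add, card_filter_add_card_filter_not]
    _ ≤ _ := by
        rw [hgood]
        exact Nat.add_le_add_left ((Nat.mul_le_mul_left _ hbad).trans hbound) _

open Finset in
open scoped Classical in
theorem card_transitive_pairs_le (n : ℕ) :
    #{p : Equiv.Perm (Fin (2 * n)) × Equiv.Perm (Fin (2 * n)) |
        (p.2 * p.2 = 1 ∧ ∀ x, p.2 x ≠ x) ∧
        ∀ x y : Fin (2 * n),
          ∃ g ∈ Subgroup.closure ({p.1, p.2} : Set (Equiv.Perm (Fin (2 * n)))), g x = y} ≤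
      (2 * n).factorial * #{τ : Equiv.Perm (Fin (2 * n)) | τ * τ = 1 ∧ ∀ x, τ x ≠ x} := by
  have h : #((univ : Finset (Equiv.Perm (Fin (2 * n)))) ×ˢ
      ({τ | τ * τ = 1 ∧ ∀ x, τ x ≠ x} : Finset (Equiv.Perm (Fin (2 * n))))) =
      (2 * n).factorial * #{τ : Equiv.Perm (Fin (2 * n)) | τ * τ = 1 ∧ ∀ x, τ x ≠ x} := by
    simp [card_product, card_univ, Fintype.card_perm]
  rw [← h]
  refine card_le_card fun p hp => ?_
  simpa using (mem_filter.1 hp).2.1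

theorem revPerm_fixedPointFree_involution (n : ℕ) :
    (Fin.revPerm : Equiv.Perm (Fin (2 * n))) * Fin.revPerm = 1 ∧
      ∀ x : Fin (2 * n), Fin.revPerm x ≠ x := by
  refine ⟨by ext; simp, fun x hx => ?_⟩
  have := congrArg Fin.val hx
  simp only [Fin.revPerm_apply, Fin.val_rev] at this
  omega


/-- The probability that a uniformly random pair consisting of a permutation of a
`2n`-element set and a fixed-point-free involution generates a transitive subgroup
tends to `1` as `n → ∞`. -/
theorem prob_transitive_with_fixed_point_free_involution_tendsto_one
    (T : ℕ → ℕ)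
    (hT : ∀ n : ℕ, 1 ≤ n →
      T n = Set.ncard {p : Equiv.Perm (Fin (2 * n)) × Equiv.Perm (Fin (2 * n)) |
        (p.2 * p.2 = 1 ∧ ∀ x, p.2 x ≠ x) ∧
        ∀ x y : Fin (2 * n),
          ∃ g ∈ Subgroup.closure ({p.1, p.2} : Set (Equiv.Perm (Fin (2 * n)))),
            g x = y}) :
    Filter.Tendsto
      (fun n : ℕ => (T n : ℝ) /
        (((2 * n).factorial : ℝ) *
          (Set.ncard {τ : Equiv.Perm (Fin (2 * n)) | τ * τ = 1 ∧ ∀ x, τ x ≠ x} : ℝ)))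
      Filter.atTop (nhds 1) := by
  classical
  set N : ℕ → ℕ := fun n => (2 * n).factorial *
    Set.ncard {τ : Equiv.Perm (Fin (2 * n)) | τ * τ = 1 ∧ ∀ x, τ x ≠ x} with hN
  have hpos : ∀ n, 0 < N n := fun n => Nat.mul_pos (Nat.factorial_pos _)
    ((Set.ncard_pos).2 ⟨_, revPerm_fixedPointFree_involution n⟩)
  have hle : ∀ n, 1 ≤ n → T n ≤ N n := by
    intro n hn
    have h := card_transitive_pairs_le n
    rw [hT n hn, hN]
    simp only [Set.ncard_eq_toFinset_card', Set.toFinset_ofPred]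
    convert h
  have hge : ∀ n, 1 ≤ n → (n - 1) * N n ≤ (n - 1) * T n + 4 * N n := by
    intro n hn
    have h := card_transitive_pairs_ge hn
    rw [hT n hn, hN]
    simp only [Set.ncard_eq_toFinset_card', Set.toFinset_ofPred]
    convert h
  have hlim : Filter.Tendsto (fun n : ℕ => 1 - 4 / ((n : ℝ) - 1)) Filter.atTop (nhds 1) := by
    have h : Filter.Tendsto (fun n : ℕ => (n : ℝ) - 1) Filter.atTop Filter.atTop :=
      Filter.tendsto_atTop_add_const_right _ _ tendsto_natCast_atTop_atTop
    simpa using (h.const_div_atTop 4).const_sub 1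
  simp only [← Nat.cast_mul]
  refine tendsto_of_tendsto_of_tendsto_of_le_of_le' hlim tendsto_const_nhds ?_ ?_
  · filter_upwards [Filter.eventually_ge_atTop 2] with n hn
    have hNpos : (0 : ℝ) < N n := by exact_mod_cast hpos n
    have hn' : (0 : ℝ) < (n : ℝ) - 1 := by
      have : (2 : ℝ) ≤ n := by exact_mod_cast hn
      linarith
    have h : ((n : ℝ) - 1) * N n ≤ ((n : ℝ) - 1) * T n + 4 * N n := by
      have := hge n (by omega)
      rw [← Nat.cast_one, ← Nat.cast_sub (by omega : 1 ≤ n)]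
      exact_mod_cast this
    change 1 - 4 / ((n : ℝ) - 1) ≤ (T n : ℝ) / N n
    rw [le_div_iff₀ hNpos, one_sub_div hn'.ne', div_mul_eq_mul_div, div_le_iff₀ hn']
    linarith
  · filter_upwards [Filter.eventually_ge_atTop 1] with n hn
    have hNpos : (0 : ℝ) < N n := by exact_mod_cast hpos n
    change (T n : ℝ) / N n ≤ 1
    rw [div_le_one hNpos]
    exact_mod_cast hle n hn
end
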